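/- Let (M, +, 0) be an additive group, X a type, e : X → M × X, and Y a nonempty type. Then there exists a Kleisli-coinductive solution h : X → M × Y of e if and only if ⤳_e is consistent. -/

import Mathlib

/-- Kleisli extension of `e : X → M × X` for the writer monad `T X = M × X`:
`klex e (t, x) = (t + u, x')` where `e x = (u, x')`. -/
def klex {M X : Type*} [AddMonoid M] (e : X → M × X) : M × X → M × X :=
  fun p => (p.1 + (e p.2).1, (e p.2).2)

/-- `x ⤳_e (t, x')` iff some iterate of the Kleisli extension sends `(0, x)` to
`(t, x')`. -/
def Leadsto {M X : Type*} [AddMonoid M] (e : X → M × X) (x : X) (p : M × X) : Prop :=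
  ∃ n : ℕ, (klex e)^[n] (0, x) = p

/-- `⤳_e` is consistent iff `x ⤳_e (t, x)` implies `t = 0`. -/
def Consistent {M X : Type*} [AddMonoid M] (e : X → M × X) : Prop :=
  ∀ (x : X) (t : M), Leadsto e x (t, x) → t = 0

/-- A Kleisli-coinductive solution of `e : X → M × X`: whenever `e x = (t, x')`
and `h x' = (u, y)`, one has `h x = (t + u, y)`. -/
def IsKleisliSolution {M X Y : Type*} [AddMonoid M]
    (e : X → M × X) (h : X → M × Y) : Prop :=
  ∀ x : X, h x = ((e x).1 + (h (e x).2).1, (h (e x).2).2)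

/-- Total weight accumulated along the first `n` steps from `x`. -/
def pathWeight {M X : Type*} [AddMonoid M] (e : X → M × X) : ℕ → X → M
  | 0, _ => 0
  | n + 1, x => (e x).1 + pathWeight e n (e x).2

/-- The underlying transition map of `e`. -/
def next {M X : Type*} (e : X → M × X) (x : X) : X := (e x).2

section AddMonoid

variable {M X : Type*} [AddMonoid M] (e : X → M × X)

theorem pathWeight_add (m n : ℕ) (x : X) :
    pathWeight e (m + n) x = pathWeight e m x + pathWeight e n ((next e)^[m] x) := by
  induction m generalizing x with
  | zero => simp [pathWeight]
  | succ m ih =>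
    rw [add_right_comm]
    simp [pathWeight, ih, next, add_assoc]

theorem klex_iterate (n : ℕ) (t : M) (x : X) :
    (klex e)^[n] (t, x) = (t + pathWeight e n x, (next e)^[n] x) := by
  induction n generalizing t x with
  | zero => simp [pathWeight]
  | succ n ih => simp [klex, ih, pathWeight, next, add_assoc]

variable {e}

theorem consistent_iff_pathWeight :
    Consistent e ↔ ∀ n x, (next e)^[n] x = x → pathWeight e n x = 0 := by
  simp only [Consistent, Leadsto, klex_iterate, zero_add, Prod.mk.injEq]
  exact ⟨fun h n x hx => h x _ ⟨n, rfl, hx⟩, fun h x t ⟨n, ht, hx⟩ => ht ▸ h n x hx⟩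

theorem IsKleisliSolution.fst_eq {Y : Type*} {h : X → M × Y} (hh : IsKleisliSolution e h)
    (n : ℕ) (x : X) : (h x).1 = pathWeight e n x + (h ((next e)^[n] x)).1 := by
  induction n generalizing x with
  | zero => simp [pathWeight]
  | succ n ih =>
    rw [hh x, ih (e x).2]
    simp [pathWeight, next, add_assoc]

/-- Under consistency, the weight of a path depends only on its endpoints. -/
theorem Consistent.pathWeight_eq (hc : Consistent e) {a b : ℕ} {x : X}
    (hab : (next e)^[a] x = (next e)^[b] x) : pathWeight e a x = pathWeight e b x := by
  wlog hle : a ≤ b generalizing a b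
  · exact (this hab.symm (le_of_not_ge hle)).symm
  obtain ⟨c, rfl⟩ := Nat.exists_eq_add_of_le hle
  rw [pathWeight_add, consistent_iff_pathWeight.1 hc c, add_zero]
  rw [← Function.iterate_add_apply, add_comm c a, hab]

end AddMonoid

theorem Consistent.pathWeight_sub_eq {M X : Type*} [AddGroup M] {e : X → M × X}
    (hc : Consistent e) {m n m' n' : ℕ} {x r : X}
    (h : (next e)^[m] x = (next e)^[n] r) (h' : (next e)^[m'] x = (next e)^[n'] r) :
    pathWeight e m x - pathWeight e n r = pathWeight e m' x - pathWeight e n' r := by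
  wlog hle : m ≤ m' generalizing m n m' n'
  · exact (this h' h (le_of_not_ge hle)).symm
  obtain ⟨k, rfl⟩ := Nat.exists_eq_add_of_le hle
  have hr : (next e)^[n'] r = (next e)^[n + k] r := by
    rw [← h', add_comm m, add_comm n, Function.iterate_add_apply, h,
      ← Function.iterate_add_apply]
  rw [hc.pathWeight_eq hr, pathWeight_add, pathWeight_add, h, add_sub_add_right_eq_sub]

/-- Two points are related when their forward orbits under `f` meet. -/
def orbitsMeetSetoid {X : Type*} (f : X → X) : Setoid X where
  r x y := ∃ m n : ℕ, f^[m] x = f^[n] y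
  iseqv :=
    { refl := fun _ => ⟨0, 0, rfl⟩
      symm := fun ⟨m, n, h⟩ => ⟨n, m, h.symm⟩
      trans := by
        rintro x y z ⟨m, n, h⟩ ⟨m', n', h'⟩
        refine ⟨m' + m, n + n', ?_⟩
        rw [Function.iterate_add_apply, h, ← Function.iterate_add_apply, add_comm,
          Function.iterate_add_apply, h', ← Function.iterate_add_apply] }

/-- If `M` is an additive group, then `e` has a Kleisli-coinductive solution
(with values in any nonempty `Y`) if and only if `⤳_e` is consistent. -/
theorem group_solvable_iff_consistent
    {M X Y : Type*} [AddGroup M] [Nonempty Y]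
    (e : X → M × X) :
    (∃ h : X → M × Y, IsKleisliSolution e h) ↔ Consistent e := by
  constructor
  · rintro ⟨h, hh⟩
    refine consistent_iff_pathWeight.2 fun n x hx => ?_
    have := hh.fst_eq n x
    rwa [hx, right_eq_add] at this
  · intro hc
    let r : X → X := fun x => (Quotient.mk (orbitsMeetSetoid (next e)) x).out
    have hr : ∀ x, ∃ m n : ℕ, (next e)^[m] x = (next e)^[n] (r x) := fun x =>
      (orbitsMeetSetoid (next e)).symm (Quotient.mk_out (s := orbitsMeetSetoid (next e)) x)
    have hr_next : ∀ x, r (e x).2 = r x := fun x =>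
      congrArg Quotient.out (Quotient.sound ⟨0, 1, rfl⟩)
    choose m n hmn using hr
    obtain ⟨y⟩ := ‹Nonempty Y›
    refine ⟨fun x => (pathWeight e (m x) x - pathWeight e (n x) (r x), y), fun x => ?_⟩
    have hx : (next e)^[m (e x).2 + 1] x = (next e)^[n (e x).2] (r x) := by
      rw [← hr_next x]
      exact hmn (e x).2
    simp only [Prod.mk.injEq, and_true]
    rw [hc.pathWeight_sub_eq (hmn x) hx, hr_next x, pathWeight, add_sub_assoc]
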